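/- arXiv:2407.15400 — 2 statements merged into one kernel-verified Lean document; each statement's English description precedes it below -/
import Mathlib

section
/- Let Ω ⊆ ℝ³ be a bounded open set. There is a constant C > 0, depending only on Ω, such that for every k ∈ (0,1], every α ∈ (0,1/2], and every (k,α)-dilute polyhedral curve γ ⊆ Ω, the total length satisfies H¹(γ) ≤ C / (α⁴ k³). -/
open MeasureTheory Filter Topology Set RealInnerProductSpace ENNReal

noncomputable section

abbrev E3 : Type := EuclideanSpace ℝ (Fin 3)

/-- The vector `(a, b, c) ∈ ℝ³`. -/
def vec3 (a b c : ℝ) : E3 := (EuclideanSpace.equiv (Fin 3) ℝ).symm ![a, b, c]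

/-- The classical curl of a smooth vector field on `ℝ³`. -/
def curl3 (φ : E3 → E3) (x : E3) : E3 :=
  vec3
    (fderiv ℝ φ x (EuclideanSpace.single 1 1) 2 - fderiv ℝ φ x (EuclideanSpace.single 2 1) 1)
    (fderiv ℝ φ x (EuclideanSpace.single 2 1) 0 - fderiv ℝ φ x (EuclideanSpace.single 0 1) 2)
    (fderiv ℝ φ x (EuclideanSpace.single 0 1) 1 - fderiv ℝ φ x (EuclideanSpace.single 1 1) 0)

/-- Smooth compactly supported test vector fields with support in `U`. -/
def TestOn (U : Set E3) (φ : E3 → E3) : Prop :=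
  ContDiff ℝ (⊤ : ℕ∞) φ ∧ HasCompactSupport φ ∧ tsupport φ ⊆ U

/-- `curl β = 0` in `U`, in the distributional (row-wise) sense, for a matrix field `β`
given by its rows `β i : E3 → E3`. -/
def CurlFreeOn {d : ℕ} (U : Set E3) (β : Fin d → E3 → E3) : Prop :=
  ∀ i, ∀ φ : E3 → E3, TestOn U φ → ∫ x in U, ⟪β i x, curl3 φ x⟫ = 0

/-- The `L^q(U)` norm of a scalar function. -/
def LqNormOn (f : E3 → ℝ) (U : Set E3) (q : ℝ) : ℝ := (∫ x in U, |f x| ^ q) ^ (1 / q)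

/-- The pointwise Frobenius norm `|β + βᵀ|` of the symmetrized matrix field. -/
def symFrob (β : Fin 3 → E3 → E3) (x : E3) : ℝ :=
  Real.sqrt (∑ i, ∑ j, (β i x j + β j x i) ^ 2)

/-- The pointwise Frobenius norm `|β|` of a matrix field with `d` rows. -/
def frobAll {d : ℕ} (β : Fin d → E3 → E3) (x : E3) : ℝ :=
  Real.sqrt (∑ i, ‖β i x‖ ^ 2)

/-- The segments `s_j = [p j, q j]`, `j < J`, form a `(k,α)`-dilute polyhedral curve in `Ω`:
each segment has length at least `k` and is contained in `closure Ω`; disjoint segments are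
at distance at least `αk`; non-disjoint distinct segments share an endpoint and form an
angle at least `α`; and no segment has an endpoint in `Ω` which is not also an endpoint of
another segment. -/
def IsDilute (Ω : Set E3) (k α : ℝ) (J : ℕ) (p q : Fin J → E3) : Prop :=
  (∀ j, segment ℝ (p j) (q j) ⊆ closure Ω) ∧
  (∀ j, k ≤ dist (p j) (q j)) ∧
  (∀ i j, segment ℝ (p i) (q i) ∩ segment ℝ (p j) (q j) = ∅ →
    ∀ x ∈ segment ℝ (p i) (q i), ∀ y ∈ segment ℝ (p j) (q j), α * k ≤ dist x y) ∧
  (∀ i j, i ≠ j → (segment ℝ (p i) (q i) ∩ segment ℝ (p j) (q j)).Nonempty →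
    ∃ e ei ej : E3, ({e, ei} : Set E3) = {p i, q i} ∧ ({e, ej} : Set E3) = {p j, q j} ∧
      α ≤ InnerProductGeometry.angle (ei - e) (ej - e)) ∧
  (∀ j, ∀ e : E3, (e = p j ∨ e = q j) → e ∈ Ω → ∃ i, i ≠ j ∧ (e = p i ∨ e = q i))

/-- Law of cosines bound: vectors of norm at least `k` forming an angle at least `α` are at
distance at least `α k / 2`. -/
lemma mul_le_two_mul_norm_sub_of_le_angle {V : Type*} [NormedAddCommGroup V]
    [InnerProductSpace ℝ V] {x y : V} {k α : ℝ} (hk : 0 < k) (hα : 0 < α)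
    (hx : k ≤ ‖x‖) (hy : k ≤ ‖y‖) (h : α ≤ InnerProductGeometry.angle x y) :
    α * k ≤ 2 * ‖x - y‖ := by
  have hpi := InnerProductGeometry.angle_le_pi x y
  have hcos : Real.cos (InnerProductGeometry.angle x y) ≤ 1 - 2 / Real.pi ^ 2 * α ^ 2 :=
    (Real.cos_le_cos_of_nonneg_of_le_pi hα.le hpi h).trans
      (Real.cos_le_one_sub_mul_cos_sq (by rw [abs_of_pos hα]; linarith))
  have hlaw :=
    InnerProductGeometry.norm_sub_sq_eq_norm_sq_add_norm_sq_sub_two_mul_norm_mul_norm_mul_cos_angle x y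
  have hpi8 : (1 : ℝ) / 8 ≤ 2 / Real.pi ^ 2 := by
    rw [div_le_div_iff₀ (by norm_num) (by positivity)]
    nlinarith [Real.pi_pos, Real.pi_le_four]
  have hc : Real.cos (InnerProductGeometry.angle x y) ≤ 1 - α ^ 2 / 8 := by
    nlinarith [mul_le_mul_of_nonneg_right hpi8 (sq_nonneg α)]
  have hxy : k * k ≤ ‖x‖ * ‖y‖ := mul_le_mul hx hy hk.le (norm_nonneg _)
  have h1 : ‖x‖ * ‖y‖ * Real.cos (InnerProductGeometry.angle x y) ≤
      ‖x‖ * ‖y‖ * (1 - α ^ 2 / 8) := mul_le_mul_of_nonneg_left hc (by positivity)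
  have h2 : k * k * α ^ 2 ≤ ‖x‖ * ‖y‖ * α ^ 2 := mul_le_mul_of_nonneg_right hxy (sq_nonneg α)
  refine le_of_sq_le_sq ?_ (by positivity)
  nlinarith [sq_nonneg (‖x‖ - ‖y‖)]

/-- The midpoint depends only on the unordered pair of endpoints. -/
lemma midpoint_eq_of_pair_eq {V : Type*} [AddCommGroup V] [Module ℝ V] {a b c d : V}
    (h : ({a, b} : Set V) = {c, d}) : midpoint ℝ a b = midpoint ℝ c d := by
  rcases Set.pair_eq_pair_iff.mp h with ⟨rfl, rfl⟩ | ⟨rfl, rfl⟩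
  · rfl
  · exact midpoint_comm _ _

/-- The distance depends only on the unordered pair of points. -/
lemma dist_eq_of_pair_eq {X : Type*} [PseudoMetricSpace X] {a b c d : X}
    (h : ({a, b} : Set X) = {c, d}) : dist a b = dist c d := by
  rcases Set.pair_eq_pair_iff.mp h with ⟨rfl, rfl⟩ | ⟨rfl, rfl⟩
  · rfl
  · exact dist_comm _ _

/-- The midpoints of the segments of a `(k,α)`-dilute polyhedral curve are `α k / 4`-separated. -/
lemma IsDilute.le_dist_midpoint {Ω : Set E3} {k α : ℝ} (hk : 0 < k) (hα : 0 < α) {J : ℕ}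
    {p q : Fin J → E3} (h : IsDilute Ω k α J p q) {i j : Fin J} (hij : i ≠ j) :
    α * k / 4 ≤ dist (midpoint ℝ (p i) (q i)) (midpoint ℝ (p j) (q j)) := by
  obtain ⟨-, hlen, hdisj, hang, -⟩ := h
  have hpos : 0 < α * k := mul_pos hα hk
  rcases Set.eq_empty_or_nonempty (segment ℝ (p i) (q i) ∩ segment ℝ (p j) (q j)) with he | hne
  · have := hdisj i j he _ (midpoint_mem_segment _ _) _ (midpoint_mem_segment _ _)
    linarith
  · obtain ⟨e, ei, ej, hi, hj, hle⟩ := hang i j hij hne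
    rw [← midpoint_eq_of_pair_eq hi, ← midpoint_eq_of_pair_eq hj]
    have hxi : k ≤ ‖ei - e‖ := by
      rw [← dist_eq_norm, dist_comm, dist_eq_of_pair_eq hi]; exact hlen i
    have hxj : k ≤ ‖ej - e‖ := by
      rw [← dist_eq_norm, dist_comm, dist_eq_of_pair_eq hj]; exact hlen j
    have hsep := mul_le_two_mul_norm_sub_of_le_angle hk hα hxi hxj hle
    have hmid : midpoint ℝ e ei - midpoint ℝ e ej = (2⁻¹ : ℝ) • ((ei - e) - (ej - e)) := by
      simp only [midpoint_eq_smul_add, invOf_eq_inv]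
      module
    rw [dist_eq_norm, hmid, norm_smul, Real.norm_of_nonneg (by norm_num)]
    linarith

/-- Packing bound: finitely many points of a ball of radius `R` in `ℝ³` with mutual distances
at least `2 r` number at most `((R + r) / r)³`. -/
lemma card_mul_pow_le_of_separated {ι : Type*} [Fintype ι] {m : ι → E3} {R r : ℝ} (hR : 0 ≤ R)
    (hr : 0 < r) (hm : ∀ i, m i ∈ Metric.closedBall (0 : E3) R)
    (hsep : Pairwise fun i j => 2 * r ≤ dist (m i) (m j)) :
    (Fintype.card ι : ℝ) * r ^ 3 ≤ (R + r) ^ 3 := by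
  have hvol (x : E3) {s : ℝ} (hs : 0 ≤ s) :
      volume (Metric.ball x s) = ENNReal.ofReal (s ^ 3) * volume (Metric.ball (0 : E3) 1) := by
    rw [Measure.addHaar_ball _ _ hs]; simp
  have hdis : Pairwise (Function.onFun Disjoint fun i => Metric.ball (m i) r) := fun i j hij =>
    Metric.ball_disjoint_ball (by linarith [hsep hij])
  have hsub : (⋃ i, Metric.ball (m i) r) ⊆ Metric.ball (0 : E3) (R + r) :=
    Set.iUnion_subset fun i => Metric.ball_subset_ball' (by
      linarith [Metric.mem_closedBall.mp (hm i)])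
  have hle := measure_mono (μ := volume) hsub
  rw [measure_iUnion hdis fun _ => measurableSet_ball, tsum_fintype, hvol _ (by positivity)] at hle
  simp only [hvol _ hr.le, Finset.sum_const, Finset.card_univ, nsmul_eq_mul, ← mul_assoc] at hle
  rw [ENNReal.mul_le_mul_iff_left (Metric.measure_ball_pos _ _ one_pos).ne'
    measure_ball_lt_top.ne, ← ENNReal.ofReal_natCast, ← ENNReal.ofReal_mul (by positivity),
    ENNReal.ofReal_le_ofReal_iff (by positivity)] at hle
  exact hle

/-- Remark 2.18: for a bounded open `Ω ⊆ ℝ³` there is a constant `C > 0`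
such that every `(k,α)`-dilute polyhedral curve `γ ⊆ Ω` with `k ∈ (0,1]`, `α ∈ (0,1/2]`
satisfies `H¹(γ) ≤ C / (α⁴ k³)`. -/
theorem statement8 (Ω : Set E3) (hΩo : IsOpen Ω) (hΩb : Bornology.IsBounded Ω) :
    ∃ C : ℝ, 0 < C ∧ ∀ k α : ℝ, k ∈ Set.Ioc (0 : ℝ) 1 → α ∈ Set.Ioc (0 : ℝ) (1 / 2) →
      ∀ J : ℕ, ∀ p q : Fin J → E3, IsDilute Ω k α J p q →
        (⋃ j, segment ℝ (p j) (q j)) ⊆ Ω →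
        (μH[1] (⋃ j, segment ℝ (p j) (q j))).toReal ≤ C / (α ^ 4 * k ^ 3) := by
  obtain ⟨R, hRpos, hR⟩ := hΩb.closure.subset_closedBall_lt 0 0
  refine ⟨1024 * R * (R + 1) ^ 3, by positivity, ?_⟩
  rintro k α ⟨hk, hk1⟩ ⟨hα, hα1⟩ J p q h -
  have hmem (j : Fin J) {x : E3} (hx : x ∈ segment ℝ (p j) (q j)) :
      x ∈ Metric.closedBall (0 : E3) R := hR (h.1 j hx)
  have hr : 0 < α * k / 8 := by positivity
  have hr1 : α * k / 8 ≤ 1 := by nlinarith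
  have hcard := card_mul_pow_le_of_separated hRpos.le hr
    (fun j => hmem j (midpoint_mem_segment (p j) (q j)))
    fun i j hij => by linarith [h.le_dist_midpoint hk hα hij]
  rw [Fintype.card_fin] at hcard
  have hcard' : (J : ℝ) * (α * k) ^ 3 ≤ 512 * (R + 1) ^ 3 := by
    have : (R + α * k / 8) ^ 3 ≤ (R + 1) ^ 3 := by gcongr
    have h8 : (α * k / 8) ^ 3 = (α * k) ^ 3 / 512 := by ring
    rw [h8] at hcard
    linarith
  have hlen : μH[1] (⋃ j, segment ℝ (p j) (q j)) ≤ ENNReal.ofReal (J * (2 * R)) := by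
    calc μH[1] (⋃ j, segment ℝ (p j) (q j))
        ≤ ∑ j, μH[1] (segment ℝ (p j) (q j)) := measure_iUnion_fintype_le _ _
      _ ≤ ∑ _j : Fin J, ENNReal.ofReal (2 * R) := by
          refine Finset.sum_le_sum fun j _ => ?_
          rw [hausdorffMeasure_segment, edist_dist]
          refine ENNReal.ofReal_le_ofReal ?_
          have h1 := Metric.mem_closedBall.mp (hmem j (left_mem_segment ℝ _ _))
          have h2 := Metric.mem_closedBall'.mp (hmem j (right_mem_segment ℝ _ _))
          linarith [dist_triangle (p j) 0 (q j)]
      _ = ENNReal.ofReal (J * (2 * R)) := by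
          rw [Finset.sum_const, Finset.card_univ, Fintype.card_fin, nsmul_eq_mul,
            ENNReal.ofReal_mul (Nat.cast_nonneg J), ENNReal.ofReal_natCast]
  refine (ENNReal.toReal_le_of_le_ofReal (by positivity) hlen).trans ?_
  rw [le_div_iff₀ (by positivity)]
  have hpow : α ^ 4 * k ^ 3 ≤ (α * k) ^ 3 := by
    rw [mul_pow]
    exact mul_le_mul_of_nonneg_right
      (pow_le_pow_of_le_one hα.le (by linarith) (by norm_num)) (by positivity)
  calc (J : ℝ) * (2 * R) * (α ^ 4 * k ^ 3) ≤ J * (2 * R) * (α * k) ^ 3 := by gcongr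
    _ = 2 * R * (J * (α * k) ^ 3) := by ring
    _ ≤ 2 * R * (512 * (R + 1) ^ 3) := by gcongr
    _ = 1024 * R * (R + 1) ^ 3 := by ring
end
end

section
/- Let B ⊆ ℝ³ be an open ball, let γ be a diameter of B (the closed segment through the center of B joining two antipodal boundary points), let t ∈ S² be a unit vector parallel to γ, let d ≥ 1, and let β ∈ L¹(B;ℝ^{d×3}) satisfy curl β = 0 in B ∖ γ. Then there exists a vector b ∈ ℝ^d such that for every row index i ∈ {1,…,d} and every φ ∈ C_c^∞(B;ℝ³): ∫_B β_i · curl φ dx = b_i ∫_γ t · φ dH¹. -/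
open MeasureTheory Filter Topology Set RealInnerProductSpace ENNReal

noncomputable section

/-- The curl as a linear function of the derivative. -/
def curlLin : (E3 →L[ℝ] E3) →ₗ[ℝ] E3 where
  toFun A := vec3
    (A (EuclideanSpace.single 1 1) 2 - A (EuclideanSpace.single 2 1) 1)
    (A (EuclideanSpace.single 2 1) 0 - A (EuclideanSpace.single 0 1) 2)
    (A (EuclideanSpace.single 0 1) 1 - A (EuclideanSpace.single 1 1) 0)
  map_add' A B := by
    ext i; fin_cases i <;> simp [vec3] <;> ring
  map_smul' c A := by
    ext i; fin_cases i <;> simp [vec3] <;> ring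

/-- The curl as a continuous linear function of the derivative. -/
def curlCLM : (E3 →L[ℝ] E3) →L[ℝ] E3 := LinearMap.toContinuousLinearMap curlLin

theorem curl3_eq (φ : E3 → E3) (x : E3) : curl3 φ x = curlCLM (fderiv ℝ φ x) := rfl

theorem curl3_add {φ ψ : E3 → E3} {x : E3} (hφ : DifferentiableAt ℝ φ x)
    (hψ : DifferentiableAt ℝ ψ x) :
    curl3 (fun y => φ y + ψ y) x = curl3 φ x + curl3 ψ x := by
  rw [curl3_eq, curl3_eq, curl3_eq, fderiv_fun_add hφ hψ, map_add]

theorem curl3_const_smul {φ : E3 → E3} {x : E3} (c : ℝ) (hφ : DifferentiableAt ℝ φ x) :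
    curl3 (fun y => c • φ y) x = c • curl3 φ x := by
  rw [curl3_eq, curl3_eq, fderiv_fun_const_smul hφ, map_smul]

theorem curl3_eq_zero_of_notMem_tsupport {φ : E3 → E3} {x : E3} (hx : x ∉ tsupport φ) :
    curl3 φ x = 0 := by
  have h : fderiv ℝ φ x = 0 := by
    by_contra h
    exact hx (support_fderiv_subset ℝ h)
  rw [curl3_eq, h, map_zero]

theorem gradient_apply (ψ : E3 → ℝ) (x : E3) (i : Fin 3) :
    gradient ψ x i = fderiv ℝ ψ x (EuclideanSpace.single i 1) := by
  rw [← inner_gradient_left, EuclideanSpace.inner_single_right]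
  simp

theorem contDiff_gradient {ψ : E3 → ℝ} (hψ : ContDiff ℝ (⊤ : ℕ∞) ψ) :
    ContDiff ℝ (⊤ : ℕ∞) (gradient ψ) := by
  have h : ContDiff ℝ (⊤ : ℕ∞) (fderiv ℝ ψ) := hψ.fderiv_right (by simp)
  exact (InnerProductSpace.toDual ℝ E3).symm.contDiff.comp h

theorem curl3_gradient {ψ : E3 → ℝ} (hψ : ContDiff ℝ (⊤ : ℕ∞) ψ) (x : E3) :
    curl3 (gradient ψ) x = 0 := by
  have h : ContDiff ℝ (⊤ : ℕ∞) (fderiv ℝ ψ) := hψ.fderiv_right (by simp)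
  have hd : DifferentiableAt ℝ (fderiv ℝ ψ) x := h.differentiable (by simp) x
  have hg : DifferentiableAt ℝ (gradient ψ) x :=
    (contDiff_gradient hψ).differentiable (by simp) x
  have key : ∀ (v : E3) (i : Fin 3), fderiv ℝ (gradient ψ) x v i
      = fderiv ℝ (fderiv ℝ ψ) x v (EuclideanSpace.single i 1) := by
    intro v i
    have h1 : HasFDerivAt (fun y => gradient ψ y i)
        ((EuclideanSpace.proj i : E3 →L[ℝ] ℝ).comp (fderiv ℝ (gradient ψ) x)) x :=
      (EuclideanSpace.proj i : E3 →L[ℝ] ℝ).hasFDerivAt.comp x hg.hasFDerivAt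
    have h2 : HasFDerivAt (fun y => fderiv ℝ ψ y (EuclideanSpace.single i 1))
        ((ContinuousLinearMap.apply ℝ ℝ (EuclideanSpace.single i (1 : ℝ) : E3)).comp
          (fderiv ℝ (fderiv ℝ ψ) x)) x :=
      (ContinuousLinearMap.apply ℝ ℝ (EuclideanSpace.single i (1 : ℝ) : E3)).hasFDerivAt.comp x
        hd.hasFDerivAt
    simp only [gradient_apply] at h1
    have := congrArg (fun A => A v) (h1.unique h2)
    simpa using this
  have symm : IsSymmSndFDerivAt ℝ ψ x :=
    hψ.contDiffAt.isSymmSndFDerivAt (by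
      rw [minSmoothness_of_isRCLikeNormedField]
      exact WithTop.coe_le_coe.2 le_top)
  ext i
  fin_cases i <;> simp [curl3, vec3, key, symm.eq _ _]

theorem TestOn.add {U : Set E3} {φ ψ : E3 → E3} (hφ : TestOn U φ) (hψ : TestOn U ψ) :
    TestOn U (fun x => φ x + ψ x) :=
  ⟨hφ.1.add hψ.1, hφ.2.1.add hψ.2.1,
    (tsupport_add φ ψ).trans (union_subset hφ.2.2 hψ.2.2)⟩

theorem TestOn.smul {U : Set E3} {φ : E3 → E3} (hφ : TestOn U φ) {η : E3 → ℝ}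
    (hη : ContDiff ℝ (⊤ : ℕ∞) η) : TestOn U (fun x => η x • φ x) := by
  refine ⟨hη.smul hφ.1, ?_, (tsupport_smul_subset_right η φ).trans hφ.2.2⟩
  exact HasCompactSupport.smul_left (f := η) hφ.2.1

theorem testOn_gradient {U : Set E3} {ψ : E3 → ℝ} (hψ : ContDiff ℝ (⊤ : ℕ∞) ψ)
    (hc : HasCompactSupport ψ) (hU : tsupport ψ ⊆ U) : TestOn U (gradient ψ) := by
  have hs : tsupport (gradient ψ) ⊆ tsupport ψ := by
    refine (closure_mono fun x hx => ?_).trans (tsupport_fderiv_subset ℝ (f := ψ))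
    intro h
    apply hx
    simp [gradient, h]
  exact ⟨contDiff_gradient hψ, hc.of_isClosed_subset (isClosed_tsupport _) hs, hs.trans hU⟩

theorem TestOn.differentiable {U : Set E3} {φ : E3 → E3} (hφ : TestOn U φ) :
    Differentiable ℝ φ := hφ.1.differentiable (by simp)

theorem TestOn.continuous_fderiv {U : Set E3} {φ : E3 → E3} (hφ : TestOn U φ) :
    Continuous (fderiv ℝ φ) := hφ.1.continuous_fderiv (by simp)

theorem TestOn.exists_norm_fderiv_le {U : Set E3} {φ : E3 → E3} (hφ : TestOn U φ) :
    ∃ C, ∀ x, ‖fderiv ℝ φ x‖ ≤ C :=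
  hφ.continuous_fderiv.bounded_above_of_compact_support (hφ.2.1.fderiv ℝ)

theorem TestOn.continuous_curl3 {U : Set E3} {φ : E3 → E3} (hφ : TestOn U φ) :
    Continuous (curl3 φ) := curlCLM.continuous.comp hφ.continuous_fderiv

theorem TestOn.integrable_inner_curl3 {U V : Set E3} {φ : E3 → E3} (hφ : TestOn U φ)
    {β : E3 → E3} (hβ : IntegrableOn β V) :
    IntegrableOn (fun x => ⟪β x, curl3 φ x⟫) V := by
  obtain ⟨C, hC⟩ := hφ.exists_norm_fderiv_le
  refine Integrable.mono' (hβ.norm.mul_const (‖curlCLM‖ * C))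
    (hβ.aestronglyMeasurable.inner hφ.continuous_curl3.aestronglyMeasurable)
    (ae_of_all _ fun x => (norm_inner_le_norm _ _).trans ?_)
  gcongr
  exact curlCLM.le_of_opNorm_le_of_le le_rfl (hC x)

theorem exists_tubular_cutoff {E : Type*} [NormedAddCommGroup E] [InnerProductSpace ℝ E]
    [FiniteDimensional ℝ E] (P : E →L[ℝ] E) (x0 : E) :
    ∃ C : ℝ, ∀ ε : ℝ, 0 < ε → ∃ η : E → ℝ, ContDiff ℝ (⊤ : ℕ∞) η ∧
      (∀ x, ‖P (x - x0)‖ ≤ ε → η x = 1) ∧ (∀ x, 2 * ε ≤ ‖P (x - x0)‖ → η x = 0) ∧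
      (∀ x, ‖η x‖ ≤ 1) ∧ ∀ x, ‖fderiv ℝ η x‖ ≤ C / ε := by
  let f : ContDiffBump (0 : E) := ⟨1, 2, one_pos, one_lt_two⟩
  have hf : ContDiff ℝ (⊤ : ℕ∞) f := f.contDiff
  obtain ⟨C, hC⟩ := (hf.continuous_fderiv (by simp)).bounded_above_of_compact_support
    (f.hasCompactSupport.fderiv ℝ)
  refine ⟨C * ‖P‖, fun ε hε => ⟨fun x => f (ε⁻¹ • P (x - x0)), ?_, ?_, ?_, ?_, ?_⟩⟩
  · fun_prop
  · intro x hx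
    apply f.one_of_mem_closedBall
    rw [mem_closedBall_zero_iff, norm_smul, norm_inv, Real.norm_of_nonneg hε.le]
    rw [inv_mul_le_iff₀ hε]
    simpa [f] using hx
  · intro x hx
    apply f.zero_of_le_dist
    rw [dist_zero_right, norm_smul, norm_inv, Real.norm_of_nonneg hε.le, le_inv_mul_iff₀ hε]
    simpa [f, mul_comm] using hx
  · intro x
    rw [Real.norm_of_nonneg f.nonneg]
    exact f.le_one
  · intro x
    have h1 : HasFDerivAt (fun x => ε⁻¹ • P (x - x0)) (ε⁻¹ • P) x := by
      have := (P.hasFDerivAt.comp x ((hasFDerivAt_id x).sub_const x0)).const_smul ε⁻¹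
      exact this
    have h2 : HasFDerivAt (fun x => f (ε⁻¹ • P (x - x0)))
        ((fderiv ℝ f (ε⁻¹ • P (x - x0))).comp (ε⁻¹ • P)) x :=
      HasFDerivAt.comp (g := f) x (hf.differentiable (by simp) _).hasFDerivAt h1
    rw [h2.fderiv]
    calc _ ≤ ‖fderiv ℝ f (ε⁻¹ • P (x - x0))‖ * ‖ε⁻¹ • P‖ := ContinuousLinearMap.opNorm_comp_le _ _
      _ ≤ C * (ε⁻¹ * ‖P‖) := by
        rw [norm_smul, norm_inv, Real.norm_of_nonneg hε.le]
        gcongr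
        exact hC _
      _ = _ := by ring

/-- The component of a vector orthogonal to the unit vector `t`. -/
def perp (t : E3) : E3 →L[ℝ] E3 :=
  ContinuousLinearMap.id ℝ E3 - (innerSL ℝ t).smulRight t

theorem perp_apply (t v : E3) : perp t v = v - ⟪t, v⟫ • t := rfl

theorem perp_smul_self {t : E3} (ht : ‖t‖ = 1) (s : ℝ) : perp t (s • t) = 0 := by
  rw [perp_apply, inner_smul_right, real_inner_self_eq_norm_sq, ht]
  simp

theorem mem_segment_diameter_iff {x0 t x : E3} {R : ℝ} (hR : 0 < R) :
    x ∈ segment ℝ (x0 - R • t) (x0 + R • t) ↔ ∃ s ∈ Icc (-R) R, x0 + s • t = x := by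
  rw [segment_eq_image']
  constructor
  · rintro ⟨θ, ⟨h0, h1⟩, rfl⟩
    refine ⟨(2 * θ - 1) * R, ⟨by nlinarith, by nlinarith⟩, ?_⟩
    module
  · rintro ⟨s, ⟨h0, h1⟩, rfl⟩
    refine ⟨(s + R) / (2 * R), ⟨by apply div_nonneg <;> linarith, ?_⟩, ?_⟩
    · rw [div_le_one (by positivity)]; linarith
    · have : (s + R) / (2 * R) * (2 * R) = s + R := by field_simp
      match_scalars
      · ring
      · linarith

theorem setIntegral_segment_diameter {x0 t : E3} {R : ℝ} (hR : 0 < R) (ht : ‖t‖ = 1)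
    (f : E3 → ℝ) :
    ∫ y in segment ℝ (x0 - R • t) (x0 + R • t), f y ∂μH[1]
      = ∫ s in (-R)..R, f (x0 + s • t) := by
  have hiso : Isometry fun s : ℝ => x0 + s • t := by
    refine Isometry.of_dist_eq fun a b => ?_
    rw [dist_add_left, dist_eq_norm, ← sub_smul, norm_smul, ht, mul_one, dist_eq_norm]
  have hemb : MeasurableEmbedding fun s : ℝ => x0 + s • t :=
    hiso.isClosedEmbedding.measurableEmbedding
  have hseg : segment ℝ (x0 - R • t) (x0 + R • t) = (fun s : ℝ => x0 + s • t) '' Icc (-R) R := by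
    ext x
    exact mem_segment_diameter_iff hR
  have hsub : segment ℝ (x0 - R • t) (x0 + R • t) ⊆ range fun s : ℝ => x0 + s • t :=
    hseg ▸ image_subset_range _ _
  have hmap := hiso.map_hausdorffMeasure (d := 1) (Or.inl zero_le_one)
  rw [← Measure.restrict_restrict_of_subset hsub, ← hmap, hemb.setIntegral_map, hseg,
    preimage_image_eq _ hiso.injective, hausdorffMeasure_real, integral_Icc_eq_integral_Ioc,
    intervalIntegral.integral_of_le (by linarith)]

theorem volume_perp_eq_zero {t : E3} (x0 : E3) :
    volume {x : E3 | perp t (x - x0) = 0} = 0 := by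
  have hp : (perp t).toLinearMap.ker ≠ ⊤ := by
    intro h
    have hle : (⊤ : Submodule ℝ E3) ≤ Submodule.span ℝ {t} := by
      intro v _
      have hv : v ∈ (perp t).toLinearMap.ker := h ▸ Submodule.mem_top
      have hv' : v - ⟪t, v⟫ • t = 0 := hv
      exact Submodule.mem_span_singleton.2 ⟨_, (sub_eq_zero.1 hv').symm⟩
    have h1 := Submodule.finrank_mono hle
    have h2 := finrank_span_le_card (R := ℝ) ({t} : Set E3)
    simp at h1 h2
    omega
  have h := Measure.addHaar_submodule volume _ hp
  have h' := measure_preimage_add_right (volume : Measure E3) (-x0)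
    ((perp t).toLinearMap.ker : Set E3)
  rw [h] at h'
  simp only [sub_eq_add_neg]
  exact h'

/-- A distributional curl which is represented by an integrable field and supported on a line does
not charge test fields vanishing on that line. -/
theorem setIntegral_inner_curl3_eq_zero_of_vanish {x0 t : E3} {R : ℝ} (hR : 0 < R) (ht : ‖t‖ = 1)
    {β : E3 → E3} (hβ : IntegrableOn β (Metric.ball x0 R))
    (hcurl : ∀ φ, TestOn (Metric.ball x0 R \ segment ℝ (x0 - R • t) (x0 + R • t)) φ →
      ∫ x in Metric.ball x0 R \ segment ℝ (x0 - R • t) (x0 + R • t), ⟪β x, curl3 φ x⟫ = 0)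
    {φ : E3 → E3} (hφ : TestOn (Metric.ball x0 R) φ) (hφ0 : ∀ s : ℝ, φ (x0 + s • t) = 0) :
    ∫ x in Metric.ball x0 R, ⟪β x, curl3 φ x⟫ = 0 := by
  obtain ⟨C, hC⟩ := exists_tubular_cutoff (perp t) x0
  obtain ⟨M, hM⟩ := hφ.exists_norm_fderiv_le
  have hM0 : 0 ≤ M := (norm_nonneg _).trans (hM 0)
  have hC0 : 0 ≤ C := by
    obtain ⟨η, -, -, -, -, h⟩ := hC 1 one_pos
    simpa using (norm_nonneg _).trans (h 0)
  choose! η hη hη1 hη0 hηle hηd using hC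
  have hcl : Continuous fun x : E3 => ‖perp t (x - x0)‖ := by fun_prop
  have hφle : ∀ x, ‖φ x‖ ≤ M * ‖perp t (x - x0)‖ := by
    intro x
    have h0 : φ (x - perp t (x - x0)) = 0 := by
      rw [← hφ0 ⟪t, x - x0⟫, perp_apply]
      congr 1
      module
    have := convex_univ.norm_image_sub_le_of_norm_fderiv_le (𝕜 := ℝ)
      (fun y _ => hφ.differentiable y) (fun y _ => hM y) (mem_univ (x - perp t (x - x0)))
      (mem_univ x)
    rwa [h0, sub_zero, sub_sub_self] at this
  have htest : ∀ ε, 0 < ε → TestOn (Metric.ball x0 R) (fun x => η ε x • φ x) :=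
    fun ε hε => hφ.smul (hη ε hε)
  have hfar : ∀ ε, 0 < ε → ∀ x, 2 * ε < ‖perp t (x - x0)‖ →
      fderiv ℝ (fun x => η ε x • φ x) x = 0 := by
    intro ε hε x hx
    have : (fun x => η ε x • φ x) =ᶠ[𝓝 x] fun _ => 0 := by
      filter_upwards [hcl.continuousAt.eventually (lt_mem_nhds hx)] with y hy
      rw [hη0 ε hε y hy.le, zero_smul]
    rw [this.fderiv_eq]
    simp
  have hbound : ∀ ε, 0 < ε → ∀ x,
      ‖fderiv ℝ (fun x => η ε x • φ x) x‖ ≤ M + C * (2 * M) := by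
    intro ε hε x
    rcases lt_or_ge (2 * ε) ‖perp t (x - x0)‖ with hx | hx
    · rw [hfar ε hε x hx, norm_zero]
      positivity
    · rw [fderiv_fun_smul ((hη ε hε).differentiable (by simp) x) (hφ.differentiable x)]
      refine (norm_add_le _ _).trans (add_le_add ?_ ?_)
      · rw [norm_smul]
        simpa using mul_le_mul (hηle ε hε x) (hM x) (norm_nonneg _) zero_le_one
      · rw [ContinuousLinearMap.norm_smulRight_apply]
        calc _ ≤ C / ε * (M * (2 * ε)) := by
              gcongr
              · exact hηd ε hε x
              · exact (hφle x).trans (by gcongr)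
          _ = C * (2 * M) := by field_simp
  have heq : ∀ ε, 0 < ε → ∫ x in Metric.ball x0 R, ⟪β x, curl3 (fun x => η ε x • φ x) x⟫
      = ∫ x in Metric.ball x0 R, ⟪β x, curl3 φ x⟫ := by
    intro ε hε
    have hη' : ContDiff ℝ (⊤ : ℕ∞) fun x => 1 - η ε x := contDiff_const.sub (hη ε hε)
    have h1 := hφ.smul hη'
    have h2 : TestOn (Metric.ball x0 R \ segment ℝ (x0 - R • t) (x0 + R • t))
        (fun x => (1 - η ε x) • φ x) := by
      refine ⟨h1.1, h1.2.1, fun x hx => ⟨h1.2.2 hx, fun hxs => ?_⟩⟩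
      have hsupp : tsupport (fun x => (1 - η ε x) • φ x) ⊆ {x | ε ≤ ‖perp t (x - x0)‖} := by
        refine closure_minimal (fun y hy => ?_) (isClosed_le continuous_const hcl)
        by_contra hlt
        apply hy
        simp [hη1 ε hε y (not_le.1 hlt).le]
      obtain ⟨s, -, rfl⟩ := (mem_segment_diameter_iff hR).1 hxs
      have := hsupp hx
      simp only [mem_ofPred_eq, add_sub_cancel_left, perp_smul_self ht, norm_zero] at this
      linarith
    have h3 : ∫ x in Metric.ball x0 R, ⟪β x, curl3 (fun x => (1 - η ε x) • φ x) x⟫ = 0 := by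
      rw [← hcurl _ h2]
      refine setIntegral_eq_of_subset_of_forall_sdiff_eq_zero measurableSet_ball sdiff_subset ?_
      intro x hx
      rw [curl3_eq_zero_of_notMem_tsupport fun h => hx.2 (h2.2.2 h), inner_zero_right]
    have h4 : ∀ x, ⟪β x, curl3 φ x⟫ = ⟪β x, curl3 (fun x => η ε x • φ x) x⟫
        + ⟪β x, curl3 (fun x => (1 - η ε x) • φ x) x⟫ := by
      intro x
      rw [← inner_add_right, ← curl3_add ((htest ε hε).differentiable x) (h1.differentiable x)]
      congr 2
      ext y : 1
      module
    simp_rw [h4]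
    rw [integral_add ((htest ε hε).integrable_inner_curl3 hβ) (h1.integrable_inner_curl3 hβ), h3,
      add_zero]
  have hpos : ∀ n : ℕ, (0 : ℝ) < 1 / ((n : ℝ) + 1) := fun n => Nat.one_div_pos_of_nat
  have hlim : Tendsto (fun n : ℕ => ∫ x in Metric.ball x0 R,
      ⟪β x, curl3 (fun x => η (1 / ((n : ℝ) + 1)) x • φ x) x⟫) atTop
      (𝓝 (∫ _ in Metric.ball x0 R, (0 : ℝ))) := by
    refine tendsto_integral_of_dominated_convergence
      (fun x => ‖β x‖ * (‖curlCLM‖ * (M + C * (2 * M)))) ?_ (hβ.norm.mul_const _) ?_ ?_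
    · exact fun n => ((htest _ (hpos n)).integrable_inner_curl3 hβ).aestronglyMeasurable
    · refine fun n => ae_of_all _ fun x => (norm_inner_le_norm _ _).trans ?_
      gcongr
      exact curlCLM.le_of_opNorm_le_of_le le_rfl (hbound _ (hpos n) x)
    · have hne : ∀ᵐ x ∂(volume.restrict (Metric.ball x0 R)), perp t (x - x0) ≠ 0 := by
        apply ae_restrict_of_ae
        rw [ae_iff]
        simpa using volume_perp_eq_zero (t := t) x0
      filter_upwards [hne] with x hx
      have hlt : ∀ᶠ n : ℕ in atTop, 2 * (1 / ((n : ℝ) + 1)) < ‖perp t (x - x0)‖ := by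
        have h := (tendsto_one_div_add_atTop_nhds_zero_nat (𝕜 := ℝ)).const_mul 2
        rw [mul_zero] at h
        exact h.eventually (gt_mem_nhds (norm_pos_iff.2 hx))
      refine tendsto_const_nhds.congr' ?_
      filter_upwards [hlt] with n hn
      rw [curl3_eq, hfar _ (hpos n) x hn, map_zero, inner_zero_right]
  rw [integral_zero] at hlim
  exact tendsto_nhds_unique (tendsto_const_nhds.congr fun n => (heq _ (hpos n)).symm) hlim

/-- A test field whose tangential integral along a diameter vanishes agrees on that diameter with
the gradient of a test function. -/
theorem exists_potential_on_diameter {x0 t : E3} {R : ℝ} (hR : 0 < R) (ht : ‖t‖ = 1)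
    {φ : E3 → E3} (hφ : TestOn (Metric.ball x0 R) φ)
    (hint : ∫ s in (-R)..R, ⟪t, φ (x0 + s • t)⟫ = 0) :
    ∃ ψ : E3 → ℝ, ContDiff ℝ (⊤ : ℕ∞) ψ ∧ HasCompactSupport ψ ∧ tsupport ψ ⊆ Metric.ball x0 R ∧
      ∀ s : ℝ, gradient ψ (x0 + s • t) = φ (x0 + s • t) := by
  obtain ⟨r, ⟨hr0, hrR⟩, hr⟩ := exists_pos_lt_subset_ball hR (isClosed_tsupport φ) hφ.2.2
  have hdist : ∀ s : ℝ, dist (x0 + s • t) x0 = |s| := fun s => by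
    simp [norm_smul, ht]
  have hφr : ∀ s : ℝ, r ≤ |s| → φ (x0 + s • t) = 0 := fun s hs =>
    image_eq_zero_of_notMem_tsupport fun h => by
      have := hr h
      rw [Metric.mem_ball, hdist] at this
      linarith
  set g : ℝ → ℝ := fun s => ⟪t, φ (x0 + s • t)⟫ with hg
  have hφd := hφ.1
  have hgd : ContDiff ℝ (⊤ : ℕ∞) g := by
    refine contDiff_const.inner ℝ (hφd.comp ?_)
    fun_prop
  have hg0 : ∀ s, r ≤ |s| → g s = 0 := fun s hs => by simp [hg, hφr s hs]
  set G : ℝ → ℝ := fun u => ∫ s in (-R)..u, g s with hG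
  have hGd : ∀ u, HasDerivAt G (g u) u := fun u =>
    (hgd.continuous.integral_hasStrictDerivAt (-R) u).hasDerivAt
  have hGs : ContDiff ℝ (⊤ : ℕ∞) G := by
    rw [contDiff_infty_iff_deriv]
    refine ⟨fun u => (hGd u).differentiableAt, ?_⟩
    rwa [show deriv G = g from funext fun u => (hGd u).deriv]
  have hG0 : ∀ u, r ≤ |u| → G u = 0 := by
    intro u hu
    have hi : ∀ a b, IntervalIntegrable g volume a b := fun a b =>
      hgd.continuous.intervalIntegrable a b
    rcases le_abs.1 hu with h | h
    · have h1 : ∫ s in R..u, g s = 0 := by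
        refine intervalIntegral.integral_zero_ae (ae_of_all _ fun s hs => hg0 s ?_)
        have := (min_le_iff.1 (le_of_lt hs.1))
        rw [le_abs]
        left
        rcases this with h | h <;> linarith
      have := intervalIntegral.integral_add_adjacent_intervals (hi (-R) R) (hi R u)
      rw [h1, hint, add_zero] at this
      exact this.symm
    · refine intervalIntegral.integral_zero_ae (ae_of_all _ fun s hs => hg0 s ?_)
      have := (le_max_iff.1 hs.2)
      rw [le_abs]
      right
      rcases this with h | h <;> linarith
  let χ : ContDiffBump x0 := ⟨r, (r + R) / 2, hr0, by linarith⟩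
  have hχd : ContDiff ℝ (⊤ : ℕ∞) χ := χ.contDiff
  have hf1 : ContDiff ℝ (⊤ : ℕ∞) fun x => ⟪φ x, perp t (x - x0)⟫ := by
    refine hφd.inner ℝ ?_
    fun_prop
  have hf2 : ContDiff ℝ (⊤ : ℕ∞) fun x => χ x * G ⟪t, x - x0⟫ := by
    exact hχd.mul (hGs.comp (contDiff_const.inner ℝ (contDiff_id.sub contDiff_const)))
  have hsupp : tsupport (fun x => ⟪φ x, perp t (x - x0)⟫ + χ x * G ⟪t, x - x0⟫)
      ⊆ Metric.closedBall x0 ((r + R) / 2) := by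
    refine closure_minimal (fun x hx => ?_) Metric.isClosed_closedBall
    by_contra hlt
    rw [Metric.mem_closedBall, not_le] at hlt
    apply hx
    have h1 : φ x = 0 := image_eq_zero_of_notMem_tsupport fun h => by
      have := hr h
      rw [Metric.mem_ball] at this
      linarith
    have h2 : χ x = 0 := χ.zero_of_le_dist hlt.le
    simp [h1, h2]
  refine ⟨fun x => ⟪φ x, perp t (x - x0)⟫ + χ x * G ⟪t, x - x0⟫, hf1.add hf2,
    (isCompact_closedBall x0 ((r + R) / 2)).of_isClosed_subset (isClosed_tsupport _) hsupp,
    hsupp.trans (Metric.closedBall_subset_ball (by linarith)), fun s => ?_⟩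
  set x := x0 + s • t with hx
  have hxs : x - x0 = s • t := by simp [hx]
  have hts : ⟪t, x - x0⟫ = s := by
    rw [hxs, inner_smul_right, real_inner_self_eq_norm_sq, ht]; ring
  have hP : HasFDerivAt (fun x => perp t (x - x0)) (perp t) x :=
    (perp t).hasFDerivAt.comp x ((hasFDerivAt_id x).sub_const x0)
  have hD1 := (hφ.differentiable x).hasFDerivAt.inner ℝ hP
  have hL : HasFDerivAt (fun x => ⟪t, x - x0⟫) (innerSL ℝ t) x :=
    (innerSL ℝ t).hasFDerivAt.comp x ((hasFDerivAt_id x).sub_const x0)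
  have hGL : HasFDerivAt (fun x => G ⟪t, x - x0⟫) (g s • innerSL ℝ t) x := by
    have h := hGd ⟪t, x - x0⟫
    have := h.comp_hasFDerivAt x hL
    rwa [hts] at this
  have hD2 : HasFDerivAt (fun x => χ x * G ⟪t, x - x0⟫) (g s • innerSL ℝ t) x := by
    have hm := (hχd.differentiable (by simp) x).hasFDerivAt.mul hGL
    refine hm.congr_fderiv ?_
    rw [hts]
    rcases lt_or_ge |s| r with h | h
    · have hmem : x ∈ Metric.ball x0 χ.rIn := by
        rw [Metric.mem_ball, hdist]; exact h
      have h1 : χ x = 1 := χ.one_of_mem_closedBall (Metric.ball_subset_closedBall hmem)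
      have h2 : fderiv ℝ χ x = 0 := by
        rw [(χ.eventuallyEq_one_of_mem_ball hmem).fderiv_eq]
        simp
      simp [h1, h2]
    · simp [hG0 s h, hg0 s h]
  refine ext_inner_right ℝ fun v => ?_
  rw [inner_gradient_left, (hD1.fun_add hD2).fderiv]
  simp only [add_apply, ContinuousLinearMap.comp_apply,
    ContinuousLinearMap.prod_apply, fderivInnerCLM_apply, smul_apply,
    innerSL_apply_apply, hxs, perp_smul_self ht, inner_zero_right, add_zero, smul_eq_mul, perp_apply,
    inner_sub_right, inner_smul_right, hg]
  rw [real_inner_comm t (φ x)]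
  ring

theorem exists_testOn_integral_pos {x0 t : E3} {R : ℝ} (hR : 0 < R) (ht : ‖t‖ = 1) :
    ∃ φ, TestOn (Metric.ball x0 R) φ ∧ 0 < ∫ s in (-R)..R, ⟪t, φ (x0 + s • t)⟫ := by
  let χ : ContDiffBump x0 := ⟨R / 3, R / 2, by linarith, by linarith⟩
  have hχd : ContDiff ℝ (⊤ : ℕ∞) χ := χ.contDiff
  have hle : tsupport (fun x => χ x • t) ⊆ tsupport χ := tsupport_smul_subset_left _ _
  have hts : tsupport χ = Metric.closedBall x0 (R / 2) := χ.tsupport_eq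
  refine ⟨fun x => χ x • t, ⟨hχd.smul contDiff_const,
    χ.hasCompactSupport.of_isClosed_subset (isClosed_tsupport _) hle, ?_⟩, ?_⟩
  · exact (hle.trans hts.subset).trans (Metric.closedBall_subset_ball (by linarith))
  · have heq : ∀ s : ℝ, ⟪t, χ (x0 + s • t) • t⟫ = χ (x0 + s • t) := fun s => by
      rw [inner_smul_right, real_inner_self_eq_norm_sq, ht]; ring
    simp only [heq]
    refine intervalIntegral.integral_pos (by linarith) ?_ (fun s _ => χ.nonneg) ⟨0, ?_, ?_⟩
    · exact (χ.continuous.comp (by fun_prop)).continuousOn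
    · constructor <;> linarith
    · refine χ.pos_of_mem_ball ?_
      simpa [χ] using by linarith

/-- Lemma 4.4: if `β ∈ L¹(B;ℝ^{d×3})` has vanishing curl off a diameter
`γ` of the ball `B`, then `curl β = b ⊗ t H¹⌞γ` for some constant vector `b ∈ ℝ^d`. -/
theorem statement9 (d : ℕ) (hd : 1 ≤ d) (x0 : E3) (R : ℝ) (hR : 0 < R)
    (t : E3) (ht : ‖t‖ = 1) (β : Fin d → E3 → E3)
    (hβL1 : ∀ i, Integrable (β i) (volume.restrict (Metric.ball x0 R)))
    (hcurl : CurlFreeOn (Metric.ball x0 R \ segment ℝ (x0 - R • t) (x0 + R • t)) β) :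
    ∃ b : Fin d → ℝ, ∀ i, ∀ φ : E3 → E3, TestOn (Metric.ball x0 R) φ →
      ∫ x in Metric.ball x0 R, ⟪β i x, curl3 φ x⟫ =
        b i * ∫ y in segment ℝ (x0 - R • t) (x0 + R • t), ⟪t, φ y⟫ ∂μH[1] := by
  let T : (E3 → E3) → ℝ := fun φ => ∫ s in (-R)..R, ⟪t, φ (x0 + s • t)⟫
  obtain ⟨φ₀, hφ₀, hpos⟩ := exists_testOn_integral_pos (x0 := x0) hR ht
  refine ⟨fun i => (∫ x in Metric.ball x0 R, ⟪β i x, curl3 φ₀ x⟫) / T φ₀, fun i φ hφ => ?_⟩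
  rw [setIntegral_segment_diameter hR ht fun y => ⟪t, φ y⟫]
  change _ = _ * T φ
  have hT0 : T φ₀ ≠ 0 := hpos.ne'
  have hvanish : ∀ θ, TestOn (Metric.ball x0 R) θ → T θ = 0 →
      ∫ x in Metric.ball x0 R, ⟪β i x, curl3 θ x⟫ = 0 := by
    intro θ hθ hTθ
    obtain ⟨ψ, hψ, hψc, hψs, hψγ⟩ := exists_potential_on_diameter hR ht hθ hTθ
    have hgrad := (testOn_gradient hψ hψc hψs).smul (contDiff_const (c := (-1 : ℝ)))
    rw [← setIntegral_inner_curl3_eq_zero_of_vanish hR ht (hβL1 i) (hcurl i) (hθ.add hgrad)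
      fun s => by rw [hψγ]; module]
    congr 1
    ext x
    rw [curl3_add (hθ.differentiable x) (hgrad.differentiable x),
      curl3_const_smul _ ((testOn_gradient hψ hψc hψs).differentiable x), curl3_gradient hψ,
      smul_zero, add_zero]
  set c : ℝ := -(T φ / T φ₀) with hc
  have hcφ₀ := hφ₀.smul (contDiff_const (c := c))
  have hcont : ∀ θ, TestOn (Metric.ball x0 R) θ →
      IntervalIntegrable (fun s : ℝ => ⟪t, θ (x0 + s • t)⟫) volume (-R) R := fun θ hθ =>
    (continuous_const.inner (hθ.1.continuous.comp (by fun_prop))).intervalIntegrable _ _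
  have hTsum : T (fun x => φ x + c • φ₀ x) = 0 := by
    simp only [T, inner_add_right, inner_smul_right]
    rw [intervalIntegral.integral_add (hcont φ hφ) ((hcont φ₀ hφ₀).const_mul c),
      intervalIntegral.integral_const_mul]
    change T φ + c * T φ₀ = 0
    rw [hc]
    field_simp
    ring
  have h := hvanish _ (hφ.add hcφ₀) hTsum
  have hcurl_sum : ∀ x, ⟪β i x, curl3 (fun x => φ x + c • φ₀ x) x⟫
      = ⟪β i x, curl3 φ x⟫ + c * ⟪β i x, curl3 φ₀ x⟫ := fun x => by
    rw [curl3_add (hφ.differentiable x) (hcφ₀.differentiable x),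
      curl3_const_smul _ (hφ₀.differentiable x), inner_add_right, inner_smul_right]
  simp only [hcurl_sum] at h
  rw [integral_add (hφ.integrable_inner_curl3 (hβL1 i))
    ((hφ₀.integrable_inner_curl3 (hβL1 i)).const_mul c), integral_const_mul] at h
  rw [eq_neg_of_add_eq_zero_left h, hc]
  ring
end
end
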